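/- Let A₁, …, Aₙ be positive invertible operators on H with mI ≤ Aⱼ ≤ MI (j = 1, …, n) for some scalars 0 < m < M, let h = M/m, and let F satisfy the arithmetic–harmonic sandwich for the probability vector ω. Then for all real p, q with 0 < q < p, K(hᵖ, −q/p)^{−1/q}·‖F(A₁ᵖ, …, Aₙᵖ)‖^{1/p} ≤ ‖F(A₁^q, …, Aₙ^q)‖^{1/q} ≤ K(hᵖ, −q/p)^{1/q}·‖F(A₁ᵖ, …, Aₙᵖ)‖^{1/p}, where ‖·‖ denotes the operator norm. -/

import Mathlib

noncomputable section

/-- The arithmetic–harmonic sandwich for the probability vector `ω`: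
`(∑ ωⱼ Bⱼ⁻¹)⁻¹ ≤ F (B₁, …, Bₙ) ≤ ∑ ωⱼ Bⱼ` for all positive invertible `B₁, …, Bₙ`,
and `F` takes values in the positive invertible operators. -/
def IsAHSandwich {E : Type*} [NormedAddCommGroup E] [InnerProductSpace ℂ E]
    [CompleteSpace E] {n : ℕ} (ω : Fin n → ℝ)
    (F : (Fin n → (E →L[ℂ] E)) → (E →L[ℂ] E)) : Prop :=
  ∀ B : Fin n → (E →L[ℂ] E), (∀ j, 0 ≤ B j) → (∀ j, IsUnit (B j)) →
    (0 ≤ F B ∧ IsUnit (F B)) ∧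
    Ring.inverse (∑ j, ω j • Ring.inverse (B j)) ≤ F B ∧
    F B ≤ ∑ j, ω j • B j

/-- The generalized Kantorovich constant `K(h, p)`, with `K(h, 0) = K(h, 1) = 1`. -/
def Kconst (h p : ℝ) : ℝ :=
  if p = 0 ∨ p = 1 then 1
  else ((h ^ p - h) / ((p - 1) * (h - 1))) *
    (((p - 1) / p) * ((h ^ p - 1) / (h ^ p - h))) ^ p

theorem rpow_tangent_le {s x y : ℝ} (hs : s < 0) (hx : 0 < x) (hy : 0 < y) :
    y ^ s * (1 + s * (x / y - 1)) ≤ x ^ s := by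
  have key : ∀ t : ℝ, 0 < t → 1 + s * (t - 1) ≤ t ^ s := by
    intro t ht
    have h1s : 0 < 1 - s := by linarith
    have hamgm := Real.geom_mean_le_arith_mean2_weighted (w₁ := 1 / (1 - s)) (w₂ := -s / (1 - s))
      (p₁ := t ^ s) (p₂ := t) (by positivity) (div_nonneg (by linarith) h1s.le)
      (by positivity) ht.le (by field_simp; ring)
    rw [← Real.rpow_mul ht.le, ← Real.rpow_add ht,
      show s * (1 / (1 - s)) + -s / (1 - s) = 0 by field_simp; ring, Real.rpow_zero] at hamgm
    have : 1 / (1 - s) * t ^ s + -s / (1 - s) * t = (t ^ s - s * t) / (1 - s) := by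
      field_simp; ring
    rw [this, le_div_iff₀ h1s] at hamgm
    linarith
  calc y ^ s * (1 + s * (x / y - 1)) ≤ y ^ s * (x / y) ^ s := by
        gcongr; exact key _ (by positivity)
    _ = x ^ s := by
        rw [Real.div_rpow hx.le hy.le]; field_simp

theorem rpow_le_chord {s h t : ℝ} (hs : s < 0) (hh : 1 < h) (h1t : 1 ≤ t) (hth : t ≤ h) :
    t ^ s ≤ (h ^ s - 1) / (h - 1) * t + (h - h ^ s) / (h - 1) := by
  have ht : 0 < t := by linarith
  have e1 := rpow_tangent_le hs one_pos ht
  have e2 := rpow_tangent_le hs (show 0 < h by linarith) ht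
  rw [Real.one_rpow] at e1
  have hh' : 0 < h - 1 := by linarith
  have e3 := add_le_add (mul_le_mul_of_nonneg_left e1 (sub_nonneg.2 hth))
    (mul_le_mul_of_nonneg_left e2 (sub_nonneg.2 h1t))
  have e4 : (h - t) * (t ^ s * (1 + s * (1 / t - 1))) + (t - 1) * (t ^ s * (1 + s * (h / t - 1)))
      = t ^ s * (h - 1) := by field_simp; ring
  rw [e4, ← le_div_iff₀ hh'] at e3
  refine e3.trans_eq ?_
  field_simp; ring

section Kantorovich

variable {s h : ℝ}

theorem kconst_of_neg (hs : s < 0) : Kconst h s = ((h ^ s - h) / ((s - 1) * (h - 1))) *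
    (((s - 1) / s) * ((h ^ s - 1) / (h ^ s - h))) ^ s := by
  rw [Kconst, if_neg (by rintro (h | h) <;> linarith)]

theorem kconst_base_pos (hs : s < 0) (hh : 1 < h) :
    0 < ((s - 1) / s) * ((h ^ s - 1) / (h ^ s - h)) := by
  have := Real.rpow_lt_one_of_one_lt_of_neg hh hs
  exact mul_pos (div_pos_of_neg_of_neg (by linarith) hs)
    (div_pos_of_neg_of_neg (by linarith) (by linarith))

theorem kconst_pos (hs : s < 0) (hh : 1 < h) : 0 < Kconst h s := by
  have := Real.rpow_lt_one_of_one_lt_of_neg hh hs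
  rw [kconst_of_neg hs]
  exact mul_pos (div_pos_of_neg_of_neg (by linarith)
    (mul_neg_of_neg_of_pos (by linarith) (by linarith)))
    (Real.rpow_pos_of_pos (kconst_base_pos hs hh) _)

theorem chord_le_kconst_mul_rpow {t : ℝ} (hs : s < 0) (hh : 1 < h) (ht : 0 < t) :
    (h ^ s - 1) / (h - 1) * t + (h - h ^ s) / (h - 1) ≤ Kconst h s * t ^ s := by
  have hlt := Real.rpow_lt_one_of_one_lt_of_neg hh hs
  have hc := kconst_base_pos hs hh
  have hD : 0 < (h ^ s - h) / ((s - 1) * (h - 1)) := div_pos_of_neg_of_neg (by linarith)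
    (mul_neg_of_neg_of_pos (by linarith) (by linarith))
  rw [kconst_of_neg hs, mul_assoc, ← Real.mul_rpow hc.le ht.le]
  have e := rpow_tangent_le hs (mul_pos hc ht) one_pos
  rw [Real.one_rpow, one_mul, div_one] at e
  refine le_trans (le_of_eq ?_) (mul_le_mul_of_nonneg_left e hD.le)
  have h1 : h - 1 ≠ 0 := by linarith
  have h2 : s - 1 ≠ 0 := by linarith
  have h3 : h ^ s - h ≠ 0 := by linarith
  have h4 : s ≠ 0 := hs.ne
  field_simp
  ring
end Kantorovich

theorem exists_affine_between_rpow {a s h : ℝ} (ha : 0 < a) (hs : s < 0) (hh : 1 < h) :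
    ∃ α β : ℝ, (∀ t, a ≤ t → t ≤ a * h → t ^ s ≤ α * t + β) ∧
      ∀ t, 0 < t → α * t + β ≤ Kconst h s * t ^ s := by
  have hscale : ∀ t, 0 < t → t ^ s = a ^ s * (t / a) ^ s := fun t ht ↦ by
    rw [Real.div_rpow ht.le ha.le]; field_simp
  have haff : ∀ t, a ^ s * ((h ^ s - 1) / (h - 1)) / a * t + a ^ s * ((h - h ^ s) / (h - 1)) =
      a ^ s * ((h ^ s - 1) / (h - 1) * (t / a) + (h - h ^ s) / (h - 1)) := fun t ↦ by ring
  refine ⟨a ^ s * ((h ^ s - 1) / (h - 1)) / a, a ^ s * ((h - h ^ s) / (h - 1)),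
    fun t h1 h2 ↦ ?_, fun t ht ↦ ?_⟩
  · rw [hscale t (ha.trans_le h1), haff]
    gcongr
    exact rpow_le_chord hs hh ((one_le_div ha).2 h1) ((div_le_iff₀' ha).2 h2)
  · rw [hscale t ht, haff, mul_left_comm]
    gcongr
    exact chord_le_kconst_mul_rpow hs hh (div_pos ht ha)

theorem cfc_affine {A : Type*} [CStarAlgebra A] {Y : A} (hY : IsSelfAdjoint Y) (α β : ℝ) :
    cfc (fun t : ℝ ↦ α * t + β) Y = α • Y + algebraMap ℝ A β := by
  rw [cfc_add_const β (fun t : ℝ ↦ α * t) Y, cfc_const_mul_id α Y]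

theorem ringInverse_smul {A : Type*} [CStarAlgebra A] {c : ℝ} (hc : c ≠ 0) {Y : A}
    (hY : IsUnit Y) :
    Ring.inverse (c • Y) = c⁻¹ • Ring.inverse Y := by
  have h : c • Y * c⁻¹ • Ring.inverse Y = 1 := by
    rw [smul_mul_smul_comm, mul_inv_cancel₀ hc, Ring.mul_inverse_cancel _ hY, one_smul]
  have hu : IsUnit (c • Y) := hY.smul (Units.mk0 c hc)
  rw [← hu.mul_right_inj, h, Ring.mul_inverse_cancel _ hu]

section CStarAlgebra

variable {A : Type*} [CStarAlgebra A] [PartialOrder A] [StarOrderedRing A]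

theorem isStrictlyPositive_of_algebraMap_le {a : ℝ} {Y : A} (ha : 0 < a)
    (h : algebraMap ℝ A a ≤ Y) : IsStrictlyPositive Y :=
  (isStrictlyPositive_algebraMap ha).of_le h

theorem spectrum_pos_of_isStrictlyPositive {Y : A} (hY : IsStrictlyPositive Y) :
    ∀ t ∈ spectrum ℝ Y, 0 < t := fun _ ht ↦
  (spectrum_nonneg_of_nonneg hY.nonneg ht).lt_of_ne fun h0 ↦
    spectrum.zero_notMem ℝ hY.isUnit (h0 ▸ ht)

theorem continuousOn_rpow_spectrum {Y : A} (hY : IsStrictlyPositive Y) (s : ℝ) :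
    ContinuousOn (fun t : ℝ ↦ t ^ s) (spectrum ℝ Y) :=
  continuousOn_id.rpow_const fun t ht ↦ Or.inl (spectrum_pos_of_isStrictlyPositive hY t ht).ne'

theorem sum_rpow_le_kconst_smul_rpow_sum {n : ℕ} {ω : Fin n → ℝ} (hω0 : ∀ j, 0 ≤ ω j)
    (hω1 : ∑ j, ω j = 1) {a s h : ℝ} (ha : 0 < a) (hs : s < 0) (hh : 1 < h) {Y : Fin n → A}
    (hY1 : ∀ j, algebraMap ℝ A a ≤ Y j) (hY2 : ∀ j, Y j ≤ algebraMap ℝ A (a * h)) :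
    ∑ j, ω j • Y j ^ s ≤ Kconst h s • (∑ j, ω j • Y j) ^ s := by
  obtain ⟨α, β, h1, h2⟩ := exists_affine_between_rpow ha hs hh
  have hYp j : IsStrictlyPositive (Y j) := isStrictlyPositive_of_algebraMap_le ha (hY1 j)
  have hS : IsStrictlyPositive (∑ j, ω j • Y j) := by
    refine isStrictlyPositive_of_algebraMap_le ha ?_
    calc algebraMap ℝ A a = ∑ j, ω j • algebraMap ℝ A a := by
          rw [← Finset.sum_smul, hω1, one_smul]
      _ ≤ _ := Finset.sum_le_sum fun j _ ↦ smul_le_smul_of_nonneg_left (hY1 j) (hω0 j)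
  have hj j : Y j ^ s ≤ α • Y j + algebraMap ℝ A β := by
    rw [CFC.rpow_eq_cfc_real (hYp j).nonneg, ← cfc_affine (hYp j).isSelfAdjoint]
    refine cfc_mono (fun t ht ↦ h1 t ?_ ?_) (continuousOn_rpow_spectrum (hYp j) s)
      (by fun_prop)
    · exact (algebraMap_le_iff_le_spectrum (hYp j).isSelfAdjoint).1 (hY1 j) t ht
    · exact (le_algebraMap_iff_spectrum_le (hYp j).isSelfAdjoint).1 (hY2 j) t ht
  calc ∑ j, ω j • Y j ^ s ≤ ∑ j, ω j • (α • Y j + algebraMap ℝ A β) :=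
        Finset.sum_le_sum fun j _ ↦ smul_le_smul_of_nonneg_left (hj j) (hω0 j)
    _ = α • (∑ j, ω j • Y j) + algebraMap ℝ A β := by
        simp_rw [smul_add, Finset.sum_add_distrib, ← Finset.sum_smul, hω1, one_smul,
          Finset.smul_sum, smul_comm α]
    _ ≤ _ := by
        rw [CFC.rpow_eq_cfc_real hS.nonneg, ← cfc_affine hS.isSelfAdjoint,
          ← cfc_const_mul _ _ _ (continuousOn_rpow_spectrum hS s)]
        exact cfc_mono (fun t ht ↦ h2 t (spectrum_pos_of_isStrictlyPositive hS t ht))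
          (by fun_prop) (continuousOn_const.mul (continuousOn_rpow_spectrum hS s))

theorem algebraMap_rpow_le_rpow {a s : ℝ} {Y : A} (ha : 0 < a) (hs : 0 ≤ s)
    (h : algebraMap ℝ A a ≤ Y) : algebraMap ℝ A (a ^ s) ≤ Y ^ s := by
  have hY := isStrictlyPositive_of_algebraMap_le ha h
  rw [CFC.rpow_eq_cfc_real hY.nonneg]
  refine algebraMap_le_cfc _ _ _ (fun t ht ↦ ?_) (continuousOn_rpow_spectrum hY s) hY.isSelfAdjoint
  exact Real.rpow_le_rpow ha.le ((algebraMap_le_iff_le_spectrum hY.isSelfAdjoint).1 h t ht) hs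

theorem rpow_le_algebraMap_rpow {b s : ℝ} {Y : A} (hY : IsStrictlyPositive Y) (hs : 0 ≤ s)
    (h : Y ≤ algebraMap ℝ A b) : Y ^ s ≤ algebraMap ℝ A (b ^ s) := by
  rw [CFC.rpow_eq_cfc_real hY.nonneg]
  refine cfc_le_algebraMap _ _ _ (fun t ht ↦ ?_) (continuousOn_rpow_spectrum hY s) hY.isSelfAdjoint
  exact Real.rpow_le_rpow (spectrum_pos_of_isStrictlyPositive hY t ht).le
    ((le_algebraMap_iff_spectrum_le hY.isSelfAdjoint).1 h t ht) hs

theorem rpow_le_algebraMap_rpow_of_nonpos {a s : ℝ} {Y : A} (ha : 0 < a) (hs : s ≤ 0)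
    (h : algebraMap ℝ A a ≤ Y) : Y ^ s ≤ algebraMap ℝ A (a ^ s) := by
  have hY := isStrictlyPositive_of_algebraMap_le ha h
  rw [CFC.rpow_eq_cfc_real hY.nonneg]
  refine cfc_le_algebraMap _ _ _ (fun t ht ↦ ?_) (continuousOn_rpow_spectrum hY s) hY.isSelfAdjoint
  exact Real.rpow_le_rpow_of_nonpos ha
    ((algebraMap_le_iff_le_spectrum hY.isSelfAdjoint).1 h t ht) hs

theorem algebraMap_rpow_le_rpow_of_nonpos {b s : ℝ} {Y : A} (hY : IsStrictlyPositive Y)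
    (hs : s ≤ 0) (h : Y ≤ algebraMap ℝ A b) : algebraMap ℝ A (b ^ s) ≤ Y ^ s := by
  rw [CFC.rpow_eq_cfc_real hY.nonneg]
  refine algebraMap_le_cfc _ _ _ (fun t ht ↦ ?_) (continuousOn_rpow_spectrum hY s) hY.isSelfAdjoint
  exact Real.rpow_le_rpow_of_nonpos (spectrum_pos_of_isStrictlyPositive hY t ht)
    ((le_algebraMap_iff_spectrum_le hY.isSelfAdjoint).1 h t ht) hs

theorem isStrictlyPositive_sum_smul {n : ℕ} {ω : Fin n → ℝ} (hω0 : ∀ j, 0 ≤ ω j)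
    (hω1 : ∑ j, ω j = 1) {Y : Fin n → A} (hY : ∀ j, IsStrictlyPositive (Y j)) :
    IsStrictlyPositive (∑ j, ω j • Y j) := by
  obtain ⟨i, hi⟩ : ∃ i, 0 < ω i := by
    by_contra! hneg
    have := Finset.sum_nonpos fun j (_ : j ∈ Finset.univ) ↦ hneg j
    linarith
  exact ((hY i).smul hi).of_le (Finset.single_le_sum
    (fun j _ ↦ smul_nonneg (hω0 j) (hY j).nonneg) (Finset.mem_univ i))

end CStarAlgebra

theorem stmt19
    {H : Type*}
    [NormedAddCommGroup H] [InnerProductSpace ℂ H] [CompleteSpace H]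
    {n : ℕ} (ω : Fin n → ℝ) (hω0 : ∀ j, 0 ≤ ω j) (hω1 : ∑ j, ω j = 1)
    (m M : ℝ) (hm : 0 < m) (hmM : m < M)
    (A : Fin n → (H →L[ℂ] H))
    (hA0 : ∀ j, 0 ≤ A j) (hAu : ∀ j, IsUnit (A j))
    (hA1 : ∀ j, m • (1 : H →L[ℂ] H) ≤ A j)
    (hA2 : ∀ j, A j ≤ M • (1 : H →L[ℂ] H))
    (F : (Fin n → (H →L[ℂ] H)) → (H →L[ℂ] H))
    (hF : IsAHSandwich ω F)
    (p q : ℝ) (hq0 : 0 < q) (hqp : q < p)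
    :
    (Kconst ((M / m) ^ p) (-(q / p))) ^ (-(1 / q)) *
        ‖F (fun j => CFC.rpow (A j) p)‖ ^ (1 / p) ≤
      ‖F (fun j => CFC.rpow (A j) q)‖ ^ (1 / q) ∧
    ‖F (fun j => CFC.rpow (A j) q)‖ ^ (1 / q) ≤
      (Kconst ((M / m) ^ p) (-(q / p))) ^ (1 / q) *
        ‖F (fun j => CFC.rpow (A j) p)‖ ^ (1 / p) := by
  have hp : 0 < p := hq0.trans hqp
  set h := (M / m) ^ p with hh_def
  set r := q / p with hr_def
  have hr : 0 < r := div_pos hq0 hp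
  have hpr : p * r = q := by rw [hr_def]; field_simp
  have hM : 0 < M := hm.trans hmM
  have hh : 1 < h := Real.one_lt_rpow ((one_lt_div hm).2 hmM) hp
  have hs : -r < 0 := neg_neg_of_pos hr
  have hK := kconst_pos hs hh
  set K := Kconst h (-r) with hK_def
  have hA j : IsStrictlyPositive (A j) := ⟨hA0 j, hAu j⟩
  have hAm j : algebraMap ℝ (H →L[ℂ] H) m ≤ A j := by
    rw [Algebra.algebraMap_eq_smul_one]; exact hA1 j
  have hAM j : A j ≤ algebraMap ℝ (H →L[ℂ] H) M := by
    rw [Algebra.algebraMap_eq_smul_one]; exact hA2 j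
  simp only [CFC.rpow_eq_pow]
  have hmh : m ^ p * h = M ^ p := by
    rw [hh_def, Real.div_rpow hM.le hm.le]; field_simp
  have hMh : M ^ (-p) * h = m ^ (-p) := by
    rw [hh_def, Real.div_rpow hM.le hm.le, Real.rpow_neg hM.le, Real.rpow_neg hm.le]
    field_simp
  have hAr (t : ℝ) j : IsStrictlyPositive (A j ^ t) := (hA j).rpow _ t
  obtain ⟨⟨hFp0, -⟩, hFp1, hFp2⟩ := hF (fun j ↦ A j ^ p) (fun j ↦ (hAr p j).nonneg)
    (fun j ↦ (hAr p j).isUnit)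
  obtain ⟨⟨hFq0, -⟩, hFq1, hFq2⟩ := hF (fun j ↦ A j ^ q) (fun j ↦ (hAr q j).nonneg)
    (fun j ↦ (hAr q j).isUnit)
  simp only [CFC.inverse_rpow _ _ hp.ne' (hA _)] at hFp1
  simp only [CFC.inverse_rpow _ _ hq0.ne' (hA _)] at hFq1
  set P := F fun j ↦ A j ^ p
  set Q := F fun j ↦ A j ^ q
  have hupper : ‖Q‖ ≤ K * ‖P‖ ^ r := by
    have hS := isStrictlyPositive_sum_smul hω0 hω1 (hAr (-p))
    have hMP := sum_rpow_le_kconst_smul_rpow_sum hω0 hω1 (Real.rpow_pos_of_pos hM (-p)) hs hh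
      (fun j ↦ algebraMap_rpow_le_rpow_of_nonpos (hA j) (neg_nonpos.2 hp.le) (hAM j))
      (fun j ↦ hMh ▸ rpow_le_algebraMap_rpow_of_nonpos hm (neg_nonpos.2 hp.le) (hAm j))
    simp only [CFC.rpow_rpow _ _ _ (neg_ne_zero.2 hp.ne') (hA _), neg_mul_neg, hpr] at hMP
    set S := ∑ j, ω j • A j ^ (-p)
    have hSr : S ^ (-r) = Ring.inverse S ^ r := by
      rw [CFC.inverse_eq_rpow_neg_one hS, CFC.rpow_rpow _ _ _ (by norm_num) hS, neg_one_mul]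
    calc ‖Q‖ ≤ ‖K • S ^ (-r)‖ :=
          CStarAlgebra.norm_le_norm_of_nonneg_of_le hFq0 (hFq2.trans hMP)
      _ = K * ‖Ring.inverse S‖ ^ r := by
          rw [norm_smul, Real.norm_of_nonneg hK.le, hSr,
            CFC.norm_rpow _ hr hS.ringInverse.nonneg]
      _ ≤ K * ‖P‖ ^ r := by
          gcongr
          exact CStarAlgebra.norm_le_norm_of_nonneg_of_le hS.ringInverse.nonneg hFp1
  have hlower : ‖P‖ ^ r ≤ K * ‖Q‖ := by
    have hS := isStrictlyPositive_sum_smul hω0 hω1 (hAr p)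
    have hT := isStrictlyPositive_sum_smul hω0 hω1 (hAr (-q))
    have hMP := sum_rpow_le_kconst_smul_rpow_sum hω0 hω1 (Real.rpow_pos_of_pos hm p) hs hh
      (fun j ↦ algebraMap_rpow_le_rpow hm hp.le (hAm j))
      (fun j ↦ hmh ▸ rpow_le_algebraMap_rpow (hA j) hp.le (hAM j))
    simp only [CFC.rpow_rpow _ _ _ hp.ne' (hA _), mul_neg, hpr] at hMP
    set S := ∑ j, ω j • A j ^ p
    have hinv : K⁻¹ • S ^ r ≤ Q := by
      have := CStarAlgebra.ringInverse_le_ringInverse hMP hT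
      rw [ringInverse_smul hK.ne' (hS.rpow _ (-r)).isUnit, CFC.inverse_rpow _ _ hs.ne hS,
        neg_neg] at this
      exact this.trans hFq1
    calc ‖P‖ ^ r ≤ ‖S‖ ^ r := by
          gcongr
          exact CStarAlgebra.norm_le_norm_of_nonneg_of_le hFp0 hFp2
      _ = K * ‖K⁻¹ • S ^ r‖ := by
          rw [norm_smul, norm_inv, Real.norm_of_nonneg hK.le, CFC.norm_rpow _ hr hS.nonneg,
            mul_inv_cancel_left₀ hK.ne']
      _ ≤ K * ‖Q‖ := by
          gcongr
          exact CStarAlgebra.norm_le_norm_of_nonneg_of_le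
            (smul_nonneg (inv_nonneg.2 hK.le) CFC.rpow_nonneg) hinv
  have hroot : (‖P‖ ^ r) ^ (1 / q) = ‖P‖ ^ (1 / p) := by
    rw [← Real.rpow_mul (norm_nonneg _), hr_def]
    congr 1
    field_simp
  have hq' : 0 ≤ 1 / q := by positivity
  constructor
  · rw [Real.rpow_neg hK.le, inv_mul_le_iff₀ (Real.rpow_pos_of_pos hK _), ← hroot,
      ← Real.mul_rpow hK.le (norm_nonneg _)]
    exact Real.rpow_le_rpow (by positivity) hlower hq'
  · rw [← hroot, ← Real.mul_rpow hK.le (by positivity)]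
    exact Real.rpow_le_rpow (norm_nonneg _) hupper hq'
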